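/- Let r ≥ 1 and let s be a nonzero integer with gcd(s, r) = 1. Define Φ : L^r → L^r by Φ(x_1, …, x_r) = (t^s·σ(x_r), σ(x_1), …, σ(x_{r−1})). Then the map f = Φ − id : L^r → L^r is bijective. -/

import Mathlib

theorem aux_pos {L : Type*} [Field L] (v : L → ℤ) (B : ℤ → AddSubgroup L)
    (hB : ∀ M x, x ∈ B M ↔ (x = 0 ∨ M ≤ v x))
    (hcomp : ∀ x : ℕ → L,
      (∀ M : ℤ, ∃ N : ℕ, ∀ a ≥ N, ∀ b ≥ N, x a - x b = 0 ∨ M ≤ v (x a - x b)) →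
      ∃ l : L, ∀ M : ℤ, ∃ N : ℕ, ∀ a ≥ N, x a - l = 0 ∨ M ≤ v (x a - l))
    (s : ℤ) (hs : 0 < s) (T : L ≃+ L) (hT : ∀ x, x ≠ 0 → v (T x) = v x + s) (w : L) :
    ∃ y, T y - y = w := by
  have hTB : ∀ M x, x ∈ B M → T x ∈ B (M + 1) := by
    intro M x hx
    rw [hB] at hx ⊢
    by_cases h0 : x = 0
    · left; simp [h0]
    · right
      have := hT x h0
      have := hx.resolve_left h0
      omega
  have hanti : ∀ M N x, M ≤ N → x ∈ B N → x ∈ B M := by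
    intro M N x h hx
    rw [hB] at hx ⊢
    exact hx.imp_right (fun h' => h.trans h')
  let y : ℕ → L := fun n => -∑ k ∈ Finset.range n, T^[k] w
  have hy1 : ∀ n, y (n+1) = y n - T^[n] w := by
    intro n
    simp only [y, Finset.sum_range_succ]; ring
  have hy2 : ∀ n, T (y n) - y n = w - T^[n] w := by
    intro n
    induction n with
    | zero => simp [y]
    | succ n ih =>
      rw [hy1, map_sub, Function.iterate_succ_apply']
      linear_combination ih
  have hw : ∀ n : ℕ, T^[n] w ∈ B (v w + n) := by
    intro n
    induction n with
    | zero => rw [hB]; simp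
    | succ n ih =>
      rw [Function.iterate_succ_apply']
      have := hTB _ _ ih
      push_cast
      rwa [← add_assoc]
  have hy3 : ∀ n j : ℕ, y (n + j) - y n ∈ B (v w + n) := by
    intro n j
    induction j with
    | zero => simp [zero_mem]
    | succ j ih =>
      rw [← add_assoc, hy1]
      have h1 := hanti (v w + n) _ _ (by push_cast; omega) (hw (n + j))
      have := sub_mem ih h1
      convert this using 1; ring
  obtain ⟨l, hl⟩ := hcomp y (by
    intro M
    refine ⟨(M - v w).toNat, fun a ha b hb => ?_⟩
    rw [← hB]
    have key : ∀ a ≥ (M - v w).toNat, y a - y (M - v w).toNat ∈ B M := by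
      intro a ha
      obtain ⟨j, rfl⟩ := Nat.exists_eq_add_of_le ha
      exact hanti _ _ _ (by omega) (hy3 _ j)
    have := sub_mem (key a ha) (key b hb)
    convert this using 1; ring)
  refine ⟨l, ?_⟩
  have hall : ∀ M : ℤ, T l - l - w ∈ B M := by
    intro M
    obtain ⟨N, hN⟩ := hl M
    let n := max N (M - v w).toNat
    have h1 : y n - l ∈ B M := (hB _ _).2 (hN n (le_max_left _ _))
    have h2 : T (y n - l) ∈ B M := hanti _ _ _ (by omega) (hTB _ _ h1)
    have h3 : T^[n] w ∈ B M := hanti _ _ _ (by omega) (hw n)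
    have h4 := sub_mem (sub_mem h1 h2) h3
    convert h4 using 1
    rw [map_sub]
    linear_combination hy2 n
  by_contra hne
  have h0 : T l - l - w ≠ 0 := fun h => hne (sub_eq_zero.1 h)
  have := ((hB _ _).1 (hall (v (T l - l - w) + 1))).resolve_left h0
  omega

theorem aux_surj {L : Type*} [Field L] (v : L → ℤ) (B : ℤ → AddSubgroup L)
    (hB : ∀ M x, x ∈ B M ↔ (x = 0 ∨ M ≤ v x))
    (hcomp : ∀ x : ℕ → L,
      (∀ M : ℤ, ∃ N : ℕ, ∀ a ≥ N, ∀ b ≥ N, x a - x b = 0 ∨ M ≤ v (x a - x b)) →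
      ∃ l : L, ∀ M : ℤ, ∃ N : ℕ, ∀ a ≥ N, x a - l = 0 ∨ M ≤ v (x a - l))
    (s : ℤ) (hs : s ≠ 0) (T : L ≃+ L) (hT : ∀ x, x ≠ 0 → v (T x) = v x + s) (w : L) :
    ∃ y, T y - y = w := by
  rcases lt_or_gt_of_ne hs with h | h
  · obtain ⟨y, hy⟩ := aux_pos v B hB hcomp (-s) (by omega) T.symm (by
      intro x hx
      have := hT (T.symm x) (by simpa using hx)
      rw [T.apply_symm_apply] at this
      omega) (-w)
    refine ⟨T.symm y, ?_⟩
    rw [T.apply_symm_apply]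
    linear_combination -hy
  · exact aux_pos v B hB hcomp s h T hT w

/-- For a nonzero integer `s` with `gcd(s, r) = 1`, the map
`f = Φ − id : L^r → L^r`, where `Φ(x_1,…,x_r) = (t^s σ(x_r), σ(x_1), …, σ(x_{r−1}))`,
is bijective. (`L` is complete for the valuation topology.) -/
theorem stmt_16 {L : Type*} [Field L] (v : L → ℤ) (t : L)
    (hv_mul : ∀ x y : L, x ≠ 0 → y ≠ 0 → v (x * y) = v x + v y)
    (hv_add : ∀ x y : L, x ≠ 0 → y ≠ 0 → x + y ≠ 0 → min (v x) (v y) ≤ v (x + y))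
    (hv_surj : ∀ n : ℤ, ∃ x : L, x ≠ 0 ∧ v x = n)
    (ht0 : t ≠ 0) (ht1 : v t = 1)
    -- completeness of `L` for the valuation topology (Cauchy sequences converge)
    (hcomp : ∀ x : ℕ → L,
      (∀ M : ℤ, ∃ N : ℕ, ∀ a ≥ N, ∀ b ≥ N, x a - x b = 0 ∨ M ≤ v (x a - x b)) →
      ∃ l : L, ∀ M : ℤ, ∃ N : ℕ, ∀ a ≥ N, x a - l = 0 ∨ M ≤ v (x a - l))
    (σ : L ≃+* L) (hσt : σ t = t) (hσv : ∀ x : L, x ≠ 0 → v (σ x) = v x)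
    (r : ℕ) (hr : 1 ≤ r) (s : ℤ) (hs : s ≠ 0) (hgcd : Int.gcd s (r : ℤ) = 1)
    (Φ : (Fin r → L) → (Fin r → L))
    (hΦ : ∀ (x : Fin r → L) (i : Fin r), Φ x i =
      if (i : ℕ) = 0 then t ^ s * σ (x (⟨r - 1, by omega⟩ : Fin r))
      else σ (x (⟨(i : ℕ) - 1, by omega⟩ : Fin r))) :
    Function.Bijective (fun x : Fin r → L => Φ x - x) := by
  have hv1 : v 1 = 0 := by
    have := hv_mul 1 1 one_ne_zero one_ne_zero
    rw [mul_one] at this; omega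
  have hvn1 : v (-1) = 0 := by
    have := hv_mul (-1) (-1) (by simp) (by simp)
    rw [neg_mul_neg, mul_one, hv1] at this; omega
  have hvneg : ∀ x, v (-x) = v x := by
    intro x
    by_cases hx : x = 0
    · simp [hx]
    · have := hv_mul (-1) x (by simp) hx
      rw [neg_one_mul] at this; omega
  have hvpow : ∀ n : ℕ, v (t ^ n) = n := by
    intro n
    induction n with
    | zero => simp [hv1]
    | succ n ih =>
      rw [pow_succ, hv_mul _ _ (pow_ne_zero _ ht0) ht0, ih, ht1]; push_cast; rfl
  have hvz : v (t ^ s) = s := by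
    obtain ⟨n, rfl | rfl⟩ := s.eq_nat_or_neg
    · rw [zpow_natCast, hvpow]
    · have h := hv_mul (t ^ n) (t ^ (-(n:ℤ))) (pow_ne_zero _ ht0) (zpow_ne_zero _ ht0)
      rw [zpow_neg, zpow_natCast, mul_inv_cancel₀ (pow_ne_zero _ ht0), hv1, hvpow] at h
      rw [zpow_neg, zpow_natCast]; omega
  let B : ℤ → AddSubgroup L := fun M =>
    { carrier := {x | x = 0 ∨ M ≤ v x}
      zero_mem' := Or.inl rfl
      neg_mem' := by
        intro x hx
        rcases hx with h | h
        · left; simp [h]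
        · right; rwa [hvneg]
      add_mem' := by
        intro x y hx hy
        simp only [Set.mem_ofPred_eq] at hx hy ⊢
        by_cases h1 : x = 0
        · simpa [h1] using hy
        by_cases h2 : y = 0
        · simpa [h2] using hx
        by_cases h3 : x + y = 0
        · exact Or.inl h3
        · right
          exact (le_min (hx.resolve_left h1) (hy.resolve_left h2)).trans (hv_add x y h1 h2 h3) }
  have hB : ∀ M x, x ∈ B M ↔ (x = 0 ∨ M ≤ v x) := fun M x => Iff.rfl
  have hu : t ^ s ≠ 0 := zpow_ne_zero _ ht0
  have hσn : ∀ (n : ℕ) x, x ≠ 0 → v ((σ ^ n : L ≃+* L) x) = v x := by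
    intro n x hx
    induction n with
    | zero => simp
    | succ n ih =>
      rw [pow_succ', RingAut.mul_apply, hσv _ ((map_ne_zero_iff (σ ^ n : L ≃+* L) (RingEquiv.injective _)).2 hx), ih]
  let T : L ≃+ L :=
    { toFun := fun x => t ^ s * (σ ^ r : L ≃+* L) x
      invFun := fun x => (σ ^ r : L ≃+* L).symm ((t ^ s)⁻¹ * x)
      left_inv := by intro x; simp only [inv_mul_cancel_left₀ hu, RingEquiv.symm_apply_apply]
      right_inv := by intro x; simp only [mul_inv_cancel_left₀ hu, RingEquiv.apply_symm_apply]
      map_add' := by intro x y; simp [mul_add] }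
  have hTd : ∀ x, T x = t ^ s * (σ ^ r : L ≃+* L) x := fun _ => rfl
  have hT : ∀ x, x ≠ 0 → v (T x) = v x + s := by
    intro x hx
    rw [hTd, hv_mul _ _ hu ((map_ne_zero_iff (σ ^ r : L ≃+* L) (RingEquiv.injective _)).2 hx), hσn _ _ hx, hvz]; ring
  obtain ⟨m, rfl⟩ : ∃ m, r = m + 1 := ⟨r - 1, by omega⟩
  have hΦ0 : ∀ (x : Fin (m+1) → L), Φ x ⟨0, by omega⟩ = t ^ s * σ (x ⟨m, by omega⟩) := by
    intro x; rw [hΦ]; simp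
  have hΦS : ∀ (x : Fin (m+1) → L) (i : ℕ) (hi : i + 1 < m + 1),
      Φ x ⟨i + 1, hi⟩ = σ (x ⟨i, by omega⟩) := by
    intro x i hi; rw [hΦ]; simp
  constructor
  · intro x y hxy
    simp only at hxy
    have hd : ∀ i, Φ x i - x i = Φ y i - y i := fun i => congrFun hxy i
    have h1 : ∀ (i : ℕ) (hi : i < m + 1), x ⟨i, hi⟩ - y ⟨i, hi⟩ =
        (σ ^ i : L ≃+* L) (x ⟨0, by omega⟩ - y ⟨0, by omega⟩) := by
      intro i
      induction i with
      | zero => intro hi; simp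
      | succ i ih =>
        intro hi
        rw [pow_succ', RingAut.mul_apply, ← ih (by omega), map_sub]
        have := hd ⟨i + 1, hi⟩
        rw [hΦS, hΦS] at this
        linear_combination -this
    have h2 := hd ⟨0, by omega⟩
    rw [hΦ0, hΦ0] at h2
    have h3 : T (x ⟨0, by omega⟩ - y ⟨0, by omega⟩) = x ⟨0, by omega⟩ - y ⟨0, by omega⟩ := by
      rw [hTd, pow_succ', RingAut.mul_apply, ← h1 m (by omega), map_sub]
      linear_combination h2
    have h4 : x ⟨0, by omega⟩ - y ⟨0, by omega⟩ = 0 := by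
      by_contra h
      have := hT _ h
      rw [h3] at this
      omega
    funext i
    have := h1 i i.2
    rw [h4, map_zero] at this
    exact sub_eq_zero.1 this
  · intro z
    let z' : ℕ → L := fun n => if h : n < m + 1 then z ⟨n, h⟩ else 0
    let c : ℕ → L := fun n => Nat.rec 0 (fun k ck => σ ck + z' (k + 1)) n
    have hc0 : c 0 = 0 := rfl
    have hcS : ∀ n, c (n + 1) = σ (c n) + z' (n + 1) := fun n => rfl
    obtain ⟨a, ha⟩ := aux_surj v B hB hcomp s hs T hT (z ⟨0, by omega⟩ + t ^ s * σ (c m))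
    rw [hTd] at ha
    refine ⟨fun i => (σ ^ (i : ℕ) : L ≃+* L) a - c i, ?_⟩
    funext ⟨i, hi⟩
    beta_reduce
    rw [Pi.sub_apply]
    rcases i with _ | i
    · rw [hΦ0]
      simp only [hc0, map_sub, pow_zero, RingAut.one_apply]
      rw [pow_succ', RingAut.mul_apply] at ha
      linear_combination ha
    · rw [hΦS]
      have hz : z' (i + 1) = z ⟨i + 1, hi⟩ := dif_pos hi
      simp only [hcS, hz, map_sub, pow_succ', RingAut.mul_apply]
      ring
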